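/- Consider the real vector space of functions ψ : ℂ → ℝ that are continuously differentiable. (a) The constant function ψ ≡ 1 satisfies Q₀(ψ) = −2π < 0. (b) If V is a linear subspace of continuously differentiable functions ψ : ℂ → ℝ such that Q₀(ψ) < 0 for every ψ ∈ V ∖ {0}, then dim V ≤ 1. Hence the index of Q₀ — the maximal dimension of a subspace on which Q₀ is negative definite — equals 1. -/

import Mathlib

open MeasureTheory Real

/-- The quadratic form `Q₀(ψ) = ∫_𝔻 ‖∇ψ‖² dA − ∫_0^{2π} ψ(e^{iθ})² dθ` on the unit disk. -/
noncomputable def Q0 (ψ : ℂ → ℝ) : ℝ :=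
  (∫ z in Metric.ball (0:ℂ) 1, ‖fderiv ℝ ψ z‖ ^ 2)
    - ∫ θ in (0:ℝ)..(2 * π), (ψ (Complex.exp (θ * Complex.I))) ^ 2

/-- Differentiation under the integral sign over a compact interval, for an integrand which is
jointly continuous together with its derivative in the parameter. -/
theorem hasDerivAt_intervalIntegral_of_continuous {F F' : ℝ → ℝ → ℝ} (a b : ℝ)
    (hF : Continuous (Function.uncurry F)) (hF' : Continuous (Function.uncurry F'))
    (hderiv : ∀ x t, HasDerivAt (fun y => F y t) (F' x t) x) (x₀ : ℝ) :
    HasDerivAt (fun x => ∫ t in a..b, F x t) (∫ t in a..b, F' x₀ t) x₀ := by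
  have hcont (x : ℝ) : Continuous (F x) := hF.comp (by fun_prop : Continuous fun t => (x, t))
  have hcont' (x : ℝ) : Continuous (F' x) := hF'.comp (by fun_prop : Continuous fun t => (x, t))
  obtain ⟨C, hC⟩ := ((isCompact_closedBall x₀ 1).prod
    (isCompact_uIcc (a := a) (b := b))).exists_bound_of_continuousOn hF'.continuousOn
  refine (intervalIntegral.hasDerivAt_integral_of_dominated_loc_of_deriv_le
    (Metric.closedBall_mem_nhds x₀ one_pos)
    (.of_forall fun x => (hcont x).aestronglyMeasurable) ((hcont x₀).intervalIntegrable _ _)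
    (hcont' x₀).aestronglyMeasurable (bound := fun _ => C) (.of_forall fun t ht x hx => ?_)
    intervalIntegrable_const (.of_forall fun t _ x _ => hderiv x t)).2
  exact hC (x, t) ⟨hx, Set.uIoc_subset_uIcc ht⟩

/-- **Wirtinger's inequality** on the circle. -/
theorem integral_sq_sub_sq_integral_le_integral_deriv_sq {f f' : ℝ → ℝ}
    (hf : ∀ x, HasDerivAt f (f' x) x) (hf' : Continuous f') (hper : f (2 * π) = f 0) :
    (∫ x in (0 : ℝ)..(2 * π), f x ^ 2) - (2 * π)⁻¹ * (∫ x in (0 : ℝ)..(2 * π), f x) ^ 2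
      ≤ ∫ x in (0 : ℝ)..(2 * π), f' x ^ 2 := by
  have hπ : (0 : ℝ) < 2 * π := two_pi_pos
  have parseval {g : ℝ → ℝ} (hg : Continuous g) :
      HasSum (fun n => ‖fourierCoeffOn hπ (fun x => (g x : ℂ)) n‖ ^ 2)
        ((2 * π)⁻¹ * ∫ x in (0 : ℝ)..(2 * π), g x ^ 2) := by
    have hL2 : MemLp (fun x => (g x : ℂ)) 2 (volume.restrict (Set.Ioc 0 (2 * π))) := by
      have hgc : Continuous fun x => (g x : ℂ) := by fun_prop
      obtain ⟨C, hC⟩ := (isCompact_Icc (a := (0 : ℝ)) (b := 2 * π)).exists_bound_of_continuousOn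
        hgc.continuousOn
      exact MemLp.of_bound hgc.aestronglyMeasurable C <|
        (ae_restrict_iff' measurableSet_Ioc).2 <| .of_forall fun x hx =>
          hC x (Set.Ioc_subset_Icc_self hx)
    simpa using hasSum_sq_fourierCoeffOn hπ hL2
  have hfc : Continuous f := continuous_iff_continuousAt.2 fun x => (hf x).continuousAt
  have hzero : ‖fourierCoeffOn hπ (fun x => (f x : ℂ)) 0‖ ^ 2
      = ((2 * π)⁻¹ * ∫ x in (0 : ℝ)..(2 * π), f x) ^ 2 := by
    rw [fourierCoeffOn_eq_integral]
    simp [intervalIntegral.integral_ofReal, mul_pow]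
  have hle (n : ℤ) (hn : n ≠ 0) : ‖fourierCoeffOn hπ (fun x => (f x : ℂ)) n‖ ^ 2
      ≤ ‖fourierCoeffOn hπ (fun x => (f' x : ℂ)) n‖ ^ 2 := by
    rw [fourierCoeffOn_of_hasDerivAt hπ hn (fun x _ => (hf x).ofReal_comp)
      ((Complex.continuous_ofReal.comp hf').intervalIntegrable _ _), hper]
    have hn' : (1 : ℝ) ≤ |(n : ℝ)| := by exact_mod_cast Int.one_le_abs hn
    have hpi := pi_pos
    gcongr
    simp only [sub_self, mul_zero, zero_sub, norm_mul, norm_neg, norm_div, norm_one]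
    simp [abs_of_pos hpi]
    field_simp
    exact le_mul_of_one_le_left (norm_nonneg _) hn'
  have key := hasSum_le (f := Function.update _ 0 0) (fun n => ?_)
    ((parseval hfc).update 0 0) (parseval hf')
  · rw [hzero] at key
    refine le_of_mul_le_mul_left (le_trans (le_of_eq ?_) key) (inv_pos.2 hπ)
    ring
  · rcases eq_or_ne n 0 with rfl | hn
    · simp
    · simpa [hn] using hle n hn

/-- Integration over the unit disk in polar coordinates. -/
theorem setIntegral_unitBall_eq_polar {g : ℂ → ℝ} (hg : Continuous g) :
    ∫ z in Metric.ball (0 : ℂ) 1, g z =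
      ∫ r in (0 : ℝ)..1, ∫ θ in (0 : ℝ)..(2 * π), r * g (r * Complex.exp (θ * Complex.I)) := by
  have hcont : Continuous fun p : ℝ × ℝ => p.1 * g (p.1 * Complex.exp (p.2 * Complex.I)) := by
    fun_prop
  have hper (r : ℝ) : Function.Periodic
      (fun θ : ℝ => r * g (r * Complex.exp (θ * Complex.I))) (2 * π) := fun θ => by
    have := Complex.exp_periodic (θ * Complex.I)
    simp [add_mul, this]
  have hshift (r : ℝ) : ∫ θ in (0 : ℝ)..(2 * π), r * g (r * Complex.exp (θ * Complex.I)) =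
      ∫ θ in Set.Ioo (-π) π, r * g (r * Complex.exp (θ * Complex.I)) := by
    have := (hper r).intervalIntegral_add_eq 0 (-π)
    rw [zero_add, show -π + 2 * π = π by ring] at this
    rw [this, intervalIntegral.integral_of_le (by linarith [pi_pos]), integral_Ioc_eq_integral_Ioo]
  simp_rw [hshift]
  rw [intervalIntegral.integral_of_le zero_le_one, integral_Ioc_eq_integral_Ioo,
    ← setIntegral_prod (fun p : ℝ × ℝ => p.1 * g (p.1 * Complex.exp (p.2 * Complex.I))),
    ← integral_indicator Metric.isOpen_ball.measurableSet, ← Complex.integral_comp_polarCoord_symm,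
    polarCoord_target]
  · rw [← integral_indicator (measurableSet_Ioi.prod measurableSet_Ioo),
      ← integral_indicator (measurableSet_Ioo.prod measurableSet_Ioo)]
    congr 1 with ⟨r, θ⟩
    have hmem : (r * Complex.exp (θ * Complex.I) ∈ Metric.ball (0 : ℂ) 1) = (|r| < 1) := by
      simp [Complex.norm_exp_ofReal_mul_I]
    by_cases hr : 0 < r
    · rw [abs_of_pos hr] at hmem
      classical
      simp only [Complex.polarCoord_symm_apply, Complex.ofReal_cos, Complex.ofReal_sin,
        ← Complex.exp_mul_I, Set.indicator_apply, hmem]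
      by_cases h1 : r < 1 <;> simp [hr, h1]
    · simp [hr]
  · exact (hcont.continuousOn.integrableOn_compact (isCompact_Icc.prod isCompact_Icc)).mono_set
      (Set.prod_mono Set.Ioo_subset_Icc_self Set.Ioo_subset_Icc_self)

/-- The operator norm of a real functional on `ℂ` dominates its values on the orthonormal basis
`(v, iv)`. -/
theorem sq_add_sq_apply_mul_I_le_sq_opNorm (L : ℂ →L[ℝ] ℝ) {v : ℂ} (hv : ‖v‖ = 1) :
    L v ^ 2 + L (v * Complex.I) ^ 2 ≤ ‖L‖ ^ 2 := by
  set a := L v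
  set b := L (v * Complex.I)
  have hw : L (v * (a + b * Complex.I)) = a ^ 2 + b ^ 2 := by
    rw [show v * (a + b * Complex.I) = a • v + b • (v * Complex.I) by
      simp only [Complex.real_smul]; ring]
    simp only [map_add, map_smul, smul_eq_mul, a, b]
    ring
  have hnorm : ‖v * (a + b * Complex.I)‖ ^ 2 = a ^ 2 + b ^ 2 := by
    rw [norm_mul, hv, one_mul, ← Complex.normSq_eq_norm_sq, Complex.normSq_add_mul_I]
  have hbound := L.le_opNorm (v * (a + b * Complex.I))
  rw [hw, norm_eq_abs, abs_of_nonneg (by positivity)] at hbound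
  have hsq := pow_le_pow_left₀ (by positivity) hbound 2
  rw [mul_pow, hnorm] at hsq
  rcases (by positivity : 0 ≤ a ^ 2 + b ^ 2).eq_or_lt with h | h
  · rw [← h]; positivity
  · nlinarith

/-- On functions with vanishing boundary mean, the boundary `L²` norm is bounded by the Dirichlet
energy: the first nonzero Steklov eigenvalue of the unit disk is at least `1`. -/
theorem Q0_nonneg_of_integral_eq_zero {ψ : ℂ → ℝ} (hψ : ContDiff ℝ 1 ψ)
    (hmean : ∫ θ in (0 : ℝ)..(2 * π), ψ (Complex.exp (θ * Complex.I)) = 0) : 0 ≤ Q0 ψ := by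
  have hπ : (0 : ℝ) < 2 * π := two_pi_pos
  have hψc := hψ.continuous
  have hD : Continuous (fderiv ℝ ψ) := hψ.continuous_fderiv one_ne_zero
  let e : ℝ → ℂ := fun θ => Complex.exp (θ * Complex.I)
  let u : ℝ → ℝ → ℝ := fun r θ => ψ (r * e θ)
  let ur : ℝ → ℝ → ℝ := fun r θ => fderiv ℝ ψ (r * e θ) (e θ)
  let ut : ℝ → ℝ → ℝ := fun r θ => r * fderiv ℝ ψ (r * e θ) (e θ * Complex.I)
  have he : Continuous e := by fun_prop
  have hu : Continuous (Function.uncurry u) := by unfold u Function.uncurry; fun_prop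
  have hur : Continuous (Function.uncurry ur) := by unfold ur Function.uncurry; fun_prop
  have hut : Continuous (Function.uncurry ut) := by unfold ut Function.uncurry; fun_prop
  have hu_r (r θ : ℝ) : HasDerivAt (fun s => u s θ) (ur r θ) r := by
    have h1 : HasDerivAt (fun s : ℝ => (s : ℂ) * e θ) (e θ) r := by
      simpa using (Complex.ofRealCLM.hasDerivAt (x := r)).mul_const (e θ)
    exact ((hψ.differentiable one_ne_zero _).hasFDerivAt).comp_hasDerivAt r h1
  have hu_t (r θ : ℝ) : HasDerivAt (u r) (ut r θ) θ := by
    have h1 : HasDerivAt (fun s : ℝ => (r : ℂ) * e s) (r • (e θ * Complex.I)) θ := by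
      have := ((Complex.ofRealCLM.hasDerivAt (x := θ)).mul_const Complex.I).cexp.const_mul (r : ℂ)
      simpa [e] using this
    have h2 := ((hψ.differentiable one_ne_zero (r * e θ)).hasFDerivAt).comp_hasDerivAt θ h1
    exact h2.congr_deriv (by simp only [map_smul, smul_eq_mul, ut])
  have hsec {w : ℝ → ℝ → ℝ} (hw : Continuous (Function.uncurry w)) (r : ℝ) : Continuous (w r) :=
    hw.comp (by fun_prop : Continuous fun t => (r, t))
  let F : ℝ → ℝ := fun r =>
    (∫ θ in (0 : ℝ)..(2 * π), u r θ ^ 2) - (2 * π)⁻¹ * (∫ θ in (0 : ℝ)..(2 * π), u r θ) ^ 2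
  let F' : ℝ → ℝ := fun r =>
    (∫ θ in (0 : ℝ)..(2 * π), 2 * u r θ * ur r θ) -
      (2 * π)⁻¹ * (2 * (∫ θ in (0 : ℝ)..(2 * π), u r θ) * ∫ θ in (0 : ℝ)..(2 * π), ur r θ)
  let G : ℝ → ℝ := fun r => ∫ θ in (0 : ℝ)..(2 * π), r * ‖fderiv ℝ ψ (r * e θ)‖ ^ 2
  have hF (r : ℝ) : HasDerivAt F (F' r) r := by
    have h1 := hasDerivAt_intervalIntegral_of_continuous 0 (2 * π) hu hur hu_r r
    have h2 := hasDerivAt_intervalIntegral_of_continuous 0 (2 * π)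
      (F := fun r θ => u r θ ^ 2) (F' := fun r θ => 2 * u r θ * ur r θ)
      (by simpa only [Function.uncurry_def] using! hu.pow 2) ((continuous_const.mul hu).mul hur)
      (fun r θ => by simpa using! (hu_r r θ).pow 2) r
    exact h2.sub (by simpa using (h1.pow 2).const_mul (2 * π)⁻¹)
  have hFc : Continuous F' := by
    refine (intervalIntegral.continuous_parametric_intervalIntegral_of_continuous'
      ((continuous_const.mul hu).mul hur) _ _).sub ?_
    have h1 := intervalIntegral.continuous_parametric_intervalIntegral_of_continuous'
      (μ := volume) hu 0 (2 * π)
    have h2 := intervalIntegral.continuous_parametric_intervalIntegral_of_continuous'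
      (μ := volume) hur 0 (2 * π)
    fun_prop
  have hGc : Continuous G := by
    refine intervalIntegral.continuous_parametric_intervalIntegral_of_continuous' ?_ _ _
    unfold Function.uncurry
    fun_prop
  have hF'G (r : ℝ) (hr : 0 < r) : F' r ≤ G r := by
    have cu := hsec hu r
    have cur := hsec hur r
    have cut := hsec hut r
    have ce : Continuous fun θ => ‖fderiv ℝ ψ (r * e θ)‖ ^ 2 := by fun_prop
    set m := (2 * π)⁻¹ * ∫ θ in (0 : ℝ)..(2 * π), u r θ with hm
    have hW := integral_sq_sub_sq_integral_le_integral_deriv_sq (hu_t r) cut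
      (by simp [u, e])
    have hvar : ∫ θ in (0 : ℝ)..(2 * π), (u r θ - m) ^ 2 =
        (∫ θ in (0 : ℝ)..(2 * π), u r θ ^ 2) -
          (2 * π)⁻¹ * (∫ θ in (0 : ℝ)..(2 * π), u r θ) ^ 2 := by
      have : ∀ θ, (u r θ - m) ^ 2 = u r θ ^ 2 - 2 * m * u r θ + m ^ 2 := fun θ => by ring
      simp_rw [this]
      rw [intervalIntegral.integral_add, intervalIntegral.integral_sub,
        intervalIntegral.integral_const_mul, intervalIntegral.integral_const, smul_eq_mul, hm]
      · field_simp
        ring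
      all_goals exact Continuous.intervalIntegrable (by fun_prop) _ _
    have hcross : F' r = ∫ θ in (0 : ℝ)..(2 * π), 2 * (u r θ - m) * ur r θ := by
      have : ∀ θ, 2 * (u r θ - m) * ur r θ = 2 * u r θ * ur r θ - 2 * m * ur r θ :=
        fun θ => by ring
      simp_rw [this]
      rw [intervalIntegral.integral_sub, intervalIntegral.integral_const_mul, hm]
      · simp only [F']
        ring
      all_goals exact Continuous.intervalIntegrable (by fun_prop) _ _
    calc F' r = ∫ θ in (0 : ℝ)..(2 * π), 2 * (u r θ - m) * ur r θ := hcross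
      _ ≤ ∫ θ in (0 : ℝ)..(2 * π), (r * ur r θ ^ 2 + r⁻¹ * (u r θ - m) ^ 2) := by
        refine intervalIntegral.integral_mono_on hπ.le
          (Continuous.intervalIntegrable (by fun_prop) _ _)
          (Continuous.intervalIntegrable (by fun_prop) _ _) fun θ _ => ?_
        have h : 0 ≤ r⁻¹ * (r * ur r θ - (u r θ - m)) ^ 2 := by positivity
        have h2 : r⁻¹ * (r * ur r θ - (u r θ - m)) ^ 2 =
            r * ur r θ ^ 2 + r⁻¹ * (u r θ - m) ^ 2 - 2 * (u r θ - m) * ur r θ := by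
          field_simp
          ring
        linarith
      _ = (∫ θ in (0 : ℝ)..(2 * π), r * ur r θ ^ 2) +
            r⁻¹ * ∫ θ in (0 : ℝ)..(2 * π), (u r θ - m) ^ 2 := by
        rw [intervalIntegral.integral_add, intervalIntegral.integral_const_mul r⁻¹]
        all_goals exact Continuous.intervalIntegrable (by fun_prop) _ _
      _ ≤ (∫ θ in (0 : ℝ)..(2 * π), r * ur r θ ^ 2) +
            r⁻¹ * ∫ θ in (0 : ℝ)..(2 * π), ut r θ ^ 2 := by
        rw [hvar]
        gcongr
      _ = ∫ θ in (0 : ℝ)..(2 * π), (r * ur r θ ^ 2 + r⁻¹ * ut r θ ^ 2) := by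
        rw [intervalIntegral.integral_add, intervalIntegral.integral_const_mul r⁻¹]
        all_goals exact Continuous.intervalIntegrable (by fun_prop) _ _
      _ ≤ G r := by
        refine intervalIntegral.integral_mono_on hπ.le
          (Continuous.intervalIntegrable (by fun_prop) _ _)
          (Continuous.intervalIntegrable (by fun_prop) _ _) fun θ _ => ?_
        have h := mul_le_mul_of_nonneg_left (sq_add_sq_apply_mul_I_le_sq_opNorm
          (fderiv ℝ ψ (r * e θ)) (Complex.norm_exp_ofReal_mul_I θ)) hr.le
        refine le_trans (le_of_eq ?_) h
        simp only [ur, ut, e]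
        field_simp
  have hFTC : ∫ r in (0 : ℝ)..1, F' r = F 1 - F 0 :=
    intervalIntegral.integral_eq_sub_of_hasDerivAt (fun r _ => hF r) (hFc.intervalIntegrable _ _)
  have hF0 : F 0 = 0 := by
    simp only [F, u, Complex.ofReal_zero, zero_mul, intervalIntegral.integral_const, smul_eq_mul]
    field_simp
    ring_nf
  have hF1 : F 1 = ∫ θ in (0 : ℝ)..(2 * π), ψ (Complex.exp (θ * Complex.I)) ^ 2 := by
    simp [F, u, e, hmean]
  have hmono : ∫ r in (0 : ℝ)..1, F' r ≤ ∫ r in (0 : ℝ)..1, G r :=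
    intervalIntegral.integral_mono_on_of_le_Ioo zero_le_one (hFc.intervalIntegrable _ _)
      (hGc.intervalIntegrable _ _) fun r hr => hF'G r hr.1
  rw [Q0, setIntegral_unitBall_eq_polar (g := fun z => ‖fderiv ℝ ψ z‖ ^ 2) (hD.norm.pow 2), sub_nonneg, ← hF1]
  rw [hFTC, hF0, sub_zero] at hmono
  exact hmono

/-- The index of `Q₀` is `1`: (a) the constant function `1` satisfies `Q₀(1) = −2π < 0`;
(b) any subspace of `C¹` functions on which `Q₀` is negative definite has dimension at
most `1`. -/
theorem index_Q0_eq_one :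
    (Q0 (fun _ => 1) = -(2 * π) ∧ Q0 (fun _ => 1) < 0)
      ∧ ∀ V : Submodule ℝ (ℂ → ℝ), (∀ ψ ∈ V, ContDiff ℝ 1 ψ) →
          (∀ ψ ∈ V, ψ ≠ 0 → Q0 ψ < 0) → Module.rank ℝ V ≤ 1 := by
  have hone : Q0 (fun _ => 1) = -(2 * π) := by simp [Q0]
  refine ⟨⟨hone, hone ▸ neg_neg_of_pos two_pi_pos⟩, fun V hV hneg => ?_⟩
  have hint (ψ : V) : IntervalIntegrable (fun θ : ℝ => (ψ : ℂ → ℝ) (Complex.exp (θ * Complex.I)))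
      volume 0 (2 * π) := by
    have := (hV ψ ψ.2).continuous
    exact Continuous.intervalIntegrable (by fun_prop) _ _
  let mean : V →ₗ[ℝ] ℝ :=
    { toFun := fun ψ => ∫ θ in (0 : ℝ)..(2 * π), (ψ : ℂ → ℝ) (Complex.exp (θ * Complex.I))
      map_add' := fun ψ φ => intervalIntegral.integral_add (hint ψ) (hint φ)
      map_smul' := fun c ψ => intervalIntegral.integral_const_mul c _ }
  have hinj : Function.Injective mean := by
    refine (injective_iff_map_eq_zero mean).2 fun ψ hψ => ?_
    by_contra h
    exact (hneg ψ ψ.2 (by simpa using h)).not_ge (Q0_nonneg_of_integral_eq_zero (hV ψ ψ.2) hψ)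
  simpa using LinearMap.rank_le_of_injective mean hinj
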